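/- Let k be a perfect field of characteristic p > 0 and let K be a finitely generated field extension of k of transcendence degree d. Then K is a finite extension of the subfield K^p = {x^p : x ∈ K} (the range of the Frobenius endomorphism of K, which is a subfield of K containing k), and the degree of this extension is exactly p^d. (This is the degree computation for the relative Frobenius Spec K → Spec K^{(p)} used in the proof of Theorem 1.) -/

import Mathlib

open MvPolynomial in
/-- Monomials with exponents `< p` are independent over the `p`-th powers. -/
theorem frobAux_indep (p d : ℕ) [Fact p.Prime] (k : Type*) [Field k] [CharP k p]
    (c : (Fin d → Fin p) → MvPolynomial (Fin d) k)
    (hc : ∑ e, c e ^ p * monomial (Finsupp.equivFunOnFinite.symm fun i => (e i : ℕ)) (1 : k) = 0)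
    (e : Fin d → Fin p) : c e = 0 := by
  have hp : p.Prime := Fact.out
  ext m
  have h := congrArg (coeff (p • m + Finsupp.equivFunOnFinite.symm fun i => (e i : ℕ))) hc
  rw [coeff_sum, Finset.sum_eq_single e] at h
  · rw [coeff_mul_monomial', if_pos (by simp), add_tsub_cancel_right, mul_one,
      ← map_frobenius_expand, coeff_map, coeff_expand_smul p hp.ne_zero] at h
    simpa [frobenius_def, hp.ne_zero] using h
  · intro e' _ hne
    rw [coeff_mul_monomial']
    split_ifs with hle
    · rw [mul_one, ← map_frobenius_expand, coeff_map]
      obtain ⟨i, hi⟩ := Function.ne_iff.mp hne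
      rw [coeff_expand_of_not_dvd (i := i), map_zero]
      have h1 := hle i
      simp at h1 ⊢
      intro hdvd
      apply hi
      have h2 : (p * m i + (e i : ℕ)) ≡ (e' i : ℕ) [MOD p] :=
        ((Nat.modEq_iff_dvd' h1).mpr hdvd).symm
      have h3 : (e i : ℕ) ≡ (e' i : ℕ) [MOD p] := by
        refine Nat.ModEq.trans ?_ h2
        simp [Nat.ModEq]
      exact Fin.ext (Nat.ModEq.eq_of_lt_of_lt h3 (e i).2 (e' i).2).symm
    · rfl
  · simp

open MvPolynomial in
/-- Every polynomial is a combination of monomials with exponents `< p`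
with coefficients `p`-th powers. -/
theorem frobAux_span (p d : ℕ) [Fact p.Prime] (k : Type*) [Field k] [CharP k p] [PerfectField k]
    (f : MvPolynomial (Fin d) k) : ∃ c : (Fin d → Fin p) → MvPolynomial (Fin d) k,
    f = ∑ e, c e ^ p * monomial (Finsupp.equivFunOnFinite.symm fun i => (e i : ℕ)) (1 : k) := by
  have hp : p.Prime := Fact.out
  classical
  induction f using MvPolynomial.induction_on' with
  | monomial u a =>
    obtain ⟨b, hb⟩ := (PerfectRing.bijective_frobenius (R := k) (p := p)).2 a
    let e₀ : Fin d → Fin p := fun i => ⟨u i % p, Nat.mod_lt _ hp.pos⟩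
    let m : Fin d →₀ ℕ := Finsupp.equivFunOnFinite.symm fun i => u i / p
    refine ⟨Pi.single e₀ (monomial m b), ?_⟩
    rw [Finset.sum_eq_single e₀]
    · rw [Pi.single_eq_same, monomial_pow, monomial_mul, mul_one]
      change b ^ p = a at hb
      rw [hb]
      congr 2
      ext i
      simp [m, e₀, Nat.div_add_mod]
    · intro e _ he
      simp [Pi.single_eq_of_ne he, hp.ne_zero]
    · simp
  | add f g hf hg =>
    obtain ⟨c, hc⟩ := hf
    obtain ⟨c', hc'⟩ := hg
    refine ⟨c + c', ?_⟩
    simp only [Pi.add_apply, add_pow_char, add_mul, Finset.sum_add_distrib]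
    rw [← hc, ← hc']

open MvPolynomial in
theorem frobAux_ratfunc (p d : ℕ) [Fact p.Prime] (k : Type*) [Field k] [CharP k p]
    [PerfectField k] (L : Type*) [Field L] [ExpChar L p] [Algebra (MvPolynomial (Fin d) k) L]
    [IsFractionRing (MvPolynomial (Fin d) k) L] :
    Module.finrank L (AdjoinPthRoots L) = p ^ d := by
  have hp : p.Prime := Fact.out
  let A := MvPolynomial (Fin d) k
  let _ : Algebra A (AdjoinPthRoots L) :=
    ((algebraMap L (AdjoinPthRoots L)).comp (algebraMap A L)).toAlgebra
  have : IsScalarTower A L (AdjoinPthRoots L) := IsScalarTower.of_algebraMap_eq' rfl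
  let v : (Fin d → Fin p) → AdjoinPthRoots L := fun e =>
    AdjoinPthRoots.root L (algebraMap A L
      (monomial (Finsupp.equivFunOnFinite.symm fun i => (e i : ℕ)) (1 : k)))
  have hsm (a : L) (x : L) : a • AdjoinPthRoots.root L x = AdjoinPthRoots.root L (a ^ p * x) := by
    rw [Algebra.smul_def, ← AdjoinPthRoots.root_pow p, map_mul, map_pow]
  have hli : LinearIndependent L v := by
    rw [← LinearIndependent.iff_fractionRing A L, Fintype.linearIndependent_iff]
    intro c hc
    apply frobAux_indep p d k c
    apply IsFractionRing.injective A L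
    apply (AdjoinPthRoots.root L).injective
    rw [map_zero, map_zero, map_sum, map_sum, ← hc]
    refine Finset.sum_congr rfl fun e _ => ?_
    rw [← IsScalarTower.algebraMap_smul L (c e) (v e), hsm, map_mul, map_pow]
  have hsp : ⊤ ≤ Submodule.span L (Set.range v) := by
    rintro y -
    obtain ⟨x, rfl⟩ := (AdjoinPthRoots.root L).surjective y
    obtain ⟨a, b, hb, rfl⟩ := IsFractionRing.div_surjective (A := A) x
    have hb0 : algebraMap A L b ≠ 0 := by
      simpa using nonZeroDivisors.ne_zero hb
    obtain ⟨c, hc⟩ := frobAux_span p d k (a * b ^ (p - 1))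
    have : algebraMap A L a / algebraMap A L b =
        ∑ e, (algebraMap A L (c e) / algebraMap A L b) ^ p * algebraMap A L
          (monomial (Finsupp.equivFunOnFinite.symm fun i => (e i : ℕ)) (1 : k)) := by
      have h := congrArg (algebraMap A L) hc
      simp only [map_sum, map_mul, map_pow] at h
      simp only [div_pow, div_mul_eq_mul_div]
      rw [← Finset.sum_div, ← h, div_eq_div_iff hb0 (pow_ne_zero _ hb0), mul_assoc, ← pow_succ,
        Nat.sub_add_cancel hp.one_le]
    rw [this, map_sum]
    refine Submodule.sum_mem _ fun e _ => ?_
    rw [← hsm]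
    exact Submodule.smul_mem _ _ (Submodule.subset_span ⟨e, rfl⟩)
  rw [Module.finrank_eq_card_basis (Module.Basis.mk hli hsp)]
  simp

theorem frobAux_equiv {E F : Type*} [Field E] [Field F] (p : ℕ) [ExpChar E p] [ExpChar F p]
    (f : E ≃+* F) :
    Module.finrank E (AdjoinPthRoots E) = Module.finrank F (AdjoinPthRoots F) := by
  refine Algebra.finrank_eq_of_equiv_equiv f
    (((AdjoinPthRoots.root E).symm.trans f).trans (AdjoinPthRoots.root F)) ?_
  ext x
  simp [← AdjoinPthRoots.root_pow p, -AdjoinPthRoots.root_pow]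

theorem frobAux_range {E : Type*} [Field E] (p : ℕ) [ExpChar E p] :
    Module.finrank E (AdjoinPthRoots E) =
      Module.finrank (RingHom.fieldRange (frobenius E p)) E := by
  refine Algebra.finrank_eq_of_equiv_equiv (RingHom.rangeRestrictFieldEquiv (frobenius E p))
    (AdjoinPthRoots.root E).symm ?_
  ext x
  simp only [RingHom.comp_apply, RingEquiv.toRingHom_eq_coe, RingEquiv.coe_toRingHom]
  rw [← AdjoinPthRoots.root_pow p, map_pow, RingEquiv.symm_apply_apply]
  rfl

theorem frobAux_finite {E F : Type*} [Field E] [Field F] [Algebra E F] (p : ℕ) [ExpChar E p]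
    [ExpChar F p] [FiniteDimensional E F] :
    Module.finrank E (AdjoinPthRoots E) = Module.finrank F (AdjoinPthRoots F) := by
  let _ : Algebra E (AdjoinPthRoots F) :=
    ((algebraMap F (AdjoinPthRoots F)).comp (algebraMap E F)).toAlgebra
  have : IsScalarTower E F (AdjoinPthRoots F) := IsScalarTower.of_algebraMap_eq' rfl
  let _ : Algebra (AdjoinPthRoots E) (AdjoinPthRoots F) :=
    (((AdjoinPthRoots.root F).toRingHom.comp (algebraMap E F)).comp
      (AdjoinPthRoots.root E).symm.toRingHom).toAlgebra
  have : IsScalarTower E (AdjoinPthRoots E) (AdjoinPthRoots F) := by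
    refine IsScalarTower.of_algebraMap_eq fun x => ?_
    rw [RingHom.algebraMap_toAlgebra, RingHom.algebraMap_toAlgebra]
    simp [← AdjoinPthRoots.root_pow p, -AdjoinPthRoots.root_pow]
  have h1 := Module.finrank_mul_finrank E F (AdjoinPthRoots F)
  have h2 := Module.finrank_mul_finrank E (AdjoinPthRoots E) (AdjoinPthRoots F)
  have h3 : Module.finrank E F = Module.finrank (AdjoinPthRoots E) (AdjoinPthRoots F) := by
    refine Algebra.finrank_eq_of_equiv_equiv (AdjoinPthRoots.root E) (AdjoinPthRoots.root F) ?_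
    ext x
    rw [RingHom.algebraMap_toAlgebra]
    simp
  have h4 : 0 < Module.finrank E F := Module.finrank_pos
  rw [← h2, ← h3, mul_comm] at h1
  exact (Nat.eq_of_mul_eq_mul_right h4 h1).symm

/-- **Degree of the relative Frobenius.**
If `k` is a perfect field of characteristic `p > 0` and `K` is a finitely
generated field extension of `k` of transcendence degree `d`, then `K` is a
finite extension of the subfield `K^p` (the range of the Frobenius
endomorphism of `K`) of degree exactly `p ^ d`. -/
theorem frobenius_fieldRange_finrank
    (p d : ℕ) [Fact p.Prime]
    (k K : Type*) [Field k] [Field K] [Algebra k K]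
    [CharP k p] [CharP K p] [PerfectField k]
    (hfg : (⊤ : IntermediateField k K).FG)
    (b : Fin d → K) (hb : IsTranscendenceBasis k b) :
    FiniteDimensional (RingHom.fieldRange (frobenius K p)) K ∧
      Module.finrank (RingHom.fieldRange (frobenius K p)) K = p ^ d := by
  have hp : p.Prime := Fact.out
  let E := IntermediateField.adjoin k (Set.range b)
  have : CharP E p := charP_of_injective_algebraMap (algebraMap k E).injective p
  have : CharP (FractionRing (MvPolynomial (Fin d) k)) p :=
    charP_of_injective_algebraMap
      (algebraMap k (FractionRing (MvPolynomial (Fin d) k))).injective p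
  have : Algebra.EssFiniteType k K := IntermediateField.fg_top_iff.mp hfg
  have : Algebra.EssFiniteType E K := Algebra.EssFiniteType.of_comp k E K
  have : Algebra.IsAlgebraic E K := hb.isAlgebraic_field
  have : FiniteDimensional E K := Algebra.finite_of_essFiniteType_of_isAlgebraic
  have h : Module.finrank (RingHom.fieldRange (frobenius K p)) K = p ^ d := by
    rw [← frobAux_range p, ← frobAux_finite (E := E) p,
      ← frobAux_equiv p hb.1.aevalEquivField.toRingEquiv]
    exact frobAux_ratfunc p d k _
  exact ⟨Module.finite_of_finrank_pos (h ▸ pow_pos hp.pos d), h⟩
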